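/- The semi-convergent integral of H_0 over (0,∞) equals 1: the function t ↦ ∫_0^t H_0(v) dv (which is well defined for t > 0 since H_0 is integrable near 0) satisfies lim_{t→∞} ∫_0^t H_0(v) dv = 1. -/

import Mathlib

open Complex Filter MeasureTheory

/-- Bessel function of the first kind of nonnegative integer order. -/
noncomputable def besselJ (n : ℕ) (z : ℂ) : ℂ :=
  (z / 2) ^ n * ∑' k : ℕ, (-(1/4 : ℂ)) ^ k * z ^ (2 * k) /
    ((Nat.factorial k : ℂ) * (Nat.factorial (n + k) : ℂ))

/-- The digamma-at-integers function: ψ(1) = -γ, ψ(m) = -γ + ∑_{j=1}^{m-1} 1/j. -/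
noncomputable def psiInt (m : ℕ) : ℝ :=
  -Real.eulerMascheroniConstant + ∑ j ∈ Finset.range (m - 1), 1 / (j + 1 : ℝ)

/-- Bessel function of the second kind of nonnegative integer order. -/
noncomputable def besselY (n : ℕ) (z : ℂ) : ℂ :=
  -(1 / (Real.pi : ℂ)) * (z / 2) ^ (-(n : ℤ)) *
      ∑ k ∈ Finset.range n, ((Nat.factorial (n - k - 1) : ℂ) / (Nat.factorial k : ℂ)) * (z ^ 2 / 4) ^ k
    + (2 / (Real.pi : ℂ)) * Complex.log (z / 2) * besselJ n z
    - (1 / (Real.pi : ℂ)) * (z / 2) ^ n *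
      ∑' k : ℕ, ((psiInt (k + 1) + psiInt (n + k + 1) : ℝ) : ℂ) * (-(1/4 : ℂ)) ^ k * z ^ (2 * k) /
        ((Nat.factorial k : ℂ) * (Nat.factorial (n + k) : ℂ))

/-- Hankel function of the first kind of integer order, with `H_{-n} = (-1)^n H_n`. -/
noncomputable def hankelH (n : ℤ) (z : ℂ) : ℂ :=
  if 0 ≤ n then besselJ n.toNat z + Complex.I * besselY n.toNat z
  else (-1 : ℂ) ^ n.natAbs * (besselJ n.natAbs z + Complex.I * besselY n.natAbs z)

section HankelIntegral

open Set Topology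

/-- A continuous function on `(0, ∞)` with a limit at `0` that is bounded near infinity is
bounded. -/
lemma exists_norm_le_of_tendsto_zero_of_eventually_le {f : ℝ → ℂ} {l : ℂ} {B : ℝ}
    (hf : ContinuousOn f (Ioi 0)) (h0 : Tendsto f (𝓝[>] 0) (𝓝 l))
    (hB : ∀ᶠ x in atTop, ‖f x‖ ≤ B) : ∃ C, 0 < C ∧ ∀ x, 0 < x → ‖f x‖ ≤ C := by
  have h1 : ∀ᶠ x in 𝓝[>] (0 : ℝ), ‖f x‖ ≤ ‖l‖ + 1 :=
    h0.norm.eventually (ge_mem_nhds (by linarith))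
  obtain ⟨δ, hδ, h1⟩ := (mem_nhdsGT_iff_exists_Ioc_subset).1 h1
  obtain ⟨R, hR⟩ := eventually_atTop.1 hB
  obtain ⟨K, hK⟩ := (isCompact_Icc (a := δ) (b := R)).exists_bound_of_continuousOn
    (hf.mono fun x hx => lt_of_lt_of_le hδ hx.1)
  refine ⟨max (‖l‖ + 1) (max K B), lt_max_of_lt_left (by positivity), fun x hx => ?_⟩
  rcases le_total x δ with hxδ | hxδ
  · exact (h1 ⟨hx, hxδ⟩).trans (le_max_left _ _)
  rcases le_total x R with hxR | hxR
  · exact (hK x ⟨hxδ, hxR⟩).trans ((le_max_left _ _).trans (le_max_right _ _))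
  · exact (hR x hxR).trans ((le_max_right _ _).trans (le_max_right _ _))

/-- Energy estimate for real solutions of the Bessel equation of order zero, written as the system
`h' = p / x`, `p' = -x h`. -/
lemma exists_energy_le {h p : ℝ → ℝ} (hh : ∀ x, 0 < x → HasDerivAt h (p x / x) x)
    (hp : ∀ x, 0 < x → HasDerivAt p (-(x * h x)) x) :
    ∃ C, ∀ x, 1 ≤ x → x * (h x ^ 2 + (p x / x) ^ 2) ≤ C := by
  set W : ℝ → ℝ := fun x => x * h x ^ 2 + p x ^ 2 / x + h x * p x / x with hW
  have hW' : ∀ x, 0 < x → HasDerivAt W (-(h x * p x / x ^ 2)) x := fun x hx => by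
    have := (((hasDerivAt_id x).mul ((hh x hx).pow 2)).add
      (((hp x hx).pow 2).div (hasDerivAt_id x) hx.ne')).add
      (((hh x hx).mul (hp x hx)).div (hasDerivAt_id x) hx.ne')
    refine this.congr_deriv ?_
    simp
    field_simp
    ring
  have hE : ∀ x, 0 < x → HasDerivAt (fun x => W x * Real.exp (1 / x))
      ((-(h x * p x / x ^ 2) - W x / x ^ 2) * Real.exp (1 / x)) x := fun x hx => by
    have h1 : HasDerivAt (fun x : ℝ => 1 / x) (-1 / x ^ 2) x := by
      simpa [neg_div] using (hasDerivAt_inv hx.ne')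
    refine ((hW' x hx).mul h1.exp).congr_deriv ?_
    field_simp
    ring
  have hlow : ∀ x, 1 ≤ x → x * (h x ^ 2 + (p x / x) ^ 2) ≤ 2 * W x := fun x hx => by
    have hx0 : 0 < x := by linarith
    have : W x = x * (h x ^ 2 + (p x / x) ^ 2) + h x * (p x / x) := by
      simp only [hW]; field_simp
    rw [this]
    nlinarith [sq_nonneg (h x + p x / x), mul_nonneg (sub_nonneg.2 hx) (sq_nonneg (h x)),
      mul_nonneg (sub_nonneg.2 hx) (sq_nonneg (p x / x))]
  have hanti : AntitoneOn (fun x => W x * Real.exp (1 / x)) (Ici 1) := by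
    refine antitoneOn_of_deriv_nonpos (convex_Ici 1)
      (fun x hx => (hE x (by linarith [mem_Ici.1 hx])).continuousAt.continuousWithinAt)
      (fun x hx => ?_) (fun x hx => ?_)
    · rw [interior_Ici] at hx
      exact (hE x (by linarith [mem_Ioi.1 hx])).differentiableAt.differentiableWithinAt
    · rw [interior_Ici] at hx
      have hx1 : 1 < x := hx
      have hx0 : 0 < x := by linarith
      rw [(hE x hx0).deriv]
      refine mul_nonpos_of_nonpos_of_nonneg ?_ (Real.exp_pos _).le
      have e : -(h x * p x / x ^ 2) - W x / x ^ 2 = -(x * (h x * (p x / x)) + W x) / x ^ 2 := by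
        field_simp
        ring
      rw [e]
      refine div_nonpos_of_nonpos_of_nonneg ?_ (by positivity)
      have h2 := hlow x hx1.le
      nlinarith [mul_nonneg hx0.le (sq_nonneg (h x + p x / x))]
  refine ⟨2 * (W 1 * Real.exp (1 / 1)), fun x hx => ?_⟩
  have h1 := hanti (mem_Ici.2 le_rfl) (mem_Ici.2 hx) hx
  have h2 := hlow x hx
  have h3 : 0 ≤ W x := by
    have : 0 ≤ x * (h x ^ 2 + (p x / x) ^ 2) := by positivity
    linarith
  have h4 : W x ≤ W x * Real.exp (1 / x) :=
    le_mul_of_one_le_right h3 (Real.one_le_exp (by positivity))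
  simp only at h1
  linarith

/-- `H` solves the Bessel equation of order zero on `(0, ∞)` with `P x = x H' x`, and
`H x = a + c log x + o(1)` at the origin. -/
structure IsBesselPair (a c : ℂ) (H P : ℝ → ℂ) : Prop where
  hasDerivAt_fst : ∀ x : ℝ, 0 < x → HasDerivAt H (P x / x) x
  hasDerivAt_snd : ∀ x : ℝ, 0 < x → HasDerivAt P (-(x * H x)) x
  tendsto_fst : Tendsto (fun x : ℝ => H x - (a + c * Real.log x)) (𝓝[>] 0) (𝓝 0)
  tendsto_snd : Tendsto P (𝓝[>] 0) (𝓝 c)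

namespace IsBesselPair

variable {a c : ℂ} {H P : ℝ → ℂ}

lemma continuousOn (hB : IsBesselPair a c H P) : ContinuousOn H (Ioi 0) := fun x hx =>
  (hB.hasDerivAt_fst x hx).continuousAt.continuousWithinAt

lemma exists_norm_le_of_one_le (hB : IsBesselPair a c H P) : ∃ C, 0 < C ∧ ∀ x : ℝ, 1 ≤ x →
    ‖H x‖ ≤ C * x ^ (-(1 / 2) : ℝ) ∧ ‖P x‖ ≤ C * x ^ (1 / 2 : ℝ) := by
  obtain ⟨C₁, h₁⟩ := exists_energy_le (h := fun x => (H x).re) (p := fun x => (P x).re)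
    (fun x hx => by
      simpa [Function.comp_def] using reCLM.hasFDerivAt.comp_hasDerivAt x (hB.hasDerivAt_fst x hx))
    (fun x hx => by
      simpa [Function.comp_def] using reCLM.hasFDerivAt.comp_hasDerivAt x (hB.hasDerivAt_snd x hx))
  obtain ⟨C₂, h₂⟩ := exists_energy_le (h := fun x => (H x).im) (p := fun x => (P x).im)
    (fun x hx => by
      simpa [Function.comp_def] using imCLM.hasFDerivAt.comp_hasDerivAt x (hB.hasDerivAt_fst x hx))
    (fun x hx => by
      simpa [Function.comp_def] using imCLM.hasFDerivAt.comp_hasDerivAt x (hB.hasDerivAt_snd x hx))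
  have key : ∀ x, 1 ≤ x → x * (‖H x‖ ^ 2 + (‖P x‖ / x) ^ 2) ≤ C₁ + C₂ := fun x hx => by
    have h1 := h₁ x hx
    have h2 := h₂ x hx
    rw [div_pow, ← normSq_eq_norm_sq, ← normSq_eq_norm_sq, normSq_apply, normSq_apply]
    simp only [div_pow] at h1 h2
    have : x * ((H x).re * (H x).re + (H x).im * (H x).im +
        ((P x).re * (P x).re + (P x).im * (P x).im) / x ^ 2) =
        x * ((H x).re ^ 2 + (P x).re ^ 2 / x ^ 2) + x * ((H x).im ^ 2 + (P x).im ^ 2 / x ^ 2) := by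
      ring
    linarith
  have hC : 0 ≤ C₁ + C₂ := le_trans (by positivity) (key 1 le_rfl)
  refine ⟨√(C₁ + C₂) + 1, by positivity, fun x hx => ?_⟩
  have hx0 : 0 < x := by linarith
  have h := key x hx
  have hs : √(C₁ + C₂) ≤ √(C₁ + C₂) + 1 := by linarith
  rw [Real.rpow_neg hx0.le, ← Real.sqrt_eq_rpow]
  have hH : x * ‖H x‖ ^ 2 ≤ C₁ + C₂ := by nlinarith [mul_nonneg hx0.le (sq_nonneg (‖P x‖ / x))]
  have hP : ‖P x‖ ^ 2 / x ≤ C₁ + C₂ := by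
    have : x * (‖P x‖ / x) ^ 2 = ‖P x‖ ^ 2 / x := by field_simp
    nlinarith [mul_nonneg hx0.le (sq_nonneg ‖H x‖)]
  constructor
  · refine le_trans ?_ (mul_le_mul_of_nonneg_right hs (by positivity))
    rw [← div_eq_mul_inv, ← Real.sqrt_div hC]
    apply Real.le_sqrt_of_sq_le
    rw [le_div_iff₀ hx0]
    linarith
  · refine le_trans ?_ (mul_le_mul_of_nonneg_right hs (by positivity))
    rw [← Real.sqrt_mul hC]
    apply Real.le_sqrt_of_sq_le
    rwa [div_le_iff₀ hx0] at hP

lemma tendsto_rpow_mul (hB : IsBesselPair a c H P) {r : ℝ} (hr : 0 < r) :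
    Tendsto (fun x : ℝ => ((x ^ r : ℝ) : ℂ) * H x) (𝓝[>] 0) (𝓝 0) := by
  have h0 : Tendsto (fun x : ℝ => x ^ r) (𝓝[>] 0) (𝓝 0) := by
    have := (Real.continuousAt_rpow_const 0 r (Or.inr hr.le)).tendsto
    rw [Real.zero_rpow hr.ne'] at this
    exact this.mono_left nhdsWithin_le_nhds
  have h1 := h0.ofReal
  have h2 := (tendsto_log_mul_rpow_nhdsGT_zero hr).ofReal
  have h3 := ((h1.mul hB.tendsto_fst).add (h1.mul_const a)).add (h2.const_mul c)
  simp only [ofReal_zero, mul_zero, zero_mul, add_zero] at h3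
  refine h3.congr fun x => ?_
  push_cast
  ring

lemma exists_norm_le (hB : IsBesselPair a c H P) :
    ∃ C, 0 < C ∧ ∀ x : ℝ, 0 < x → ‖H x‖ ≤ C * x ^ (-(1 / 2) : ℝ) := by
  obtain ⟨C, hC, h⟩ := hB.exists_norm_le_of_one_le
  have aux : ∀ x : ℝ, 0 < x → ‖((x ^ (1 / 2 : ℝ) : ℝ) : ℂ) * H x‖ = x ^ (1 / 2 : ℝ) * ‖H x‖ :=
    fun x hx => by rw [norm_mul, norm_real, Real.norm_of_nonneg (by positivity)]
  obtain ⟨K, hK, h⟩ := exists_norm_le_of_tendsto_zero_of_eventually_le (B := C)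
    (f := fun x : ℝ => ((x ^ (1 / 2 : ℝ) : ℝ) : ℂ) * H x)
    (ContinuousOn.mul (continuous_ofReal.comp_continuousOn
      (ContinuousOn.rpow_const continuousOn_id fun x hx => Or.inr (by norm_num))) hB.continuousOn)
    (hB.tendsto_rpow_mul (by norm_num))
    (by
      filter_upwards [eventually_ge_atTop 1] with x hx
      have hx0 : 0 < x := by linarith
      rw [aux x hx0, mul_comm, ← le_div_iff₀ (by positivity), div_eq_mul_inv, ← Real.rpow_neg hx0.le]
      exact (h x hx).1)
  refine ⟨K, hK, fun x hx => ?_⟩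
  have := h x hx
  rwa [aux x hx, mul_comm, ← le_div_iff₀ (by positivity), div_eq_mul_inv,
    ← Real.rpow_neg hx.le] at this

end IsBesselPair

lemma integrableOn_exp_neg_mul_of_norm_le {f : ℝ → ℂ} {C r s : ℝ} (hf : ContinuousOn f (Ioi 0))
    (hr : -1 < r) (hs : 0 < s) (hC : ∀ x : ℝ, 0 < x → ‖f x‖ ≤ C * x ^ r) :
    IntegrableOn (fun x : ℝ => (Real.exp (-(s * x)) : ℂ) * f x) (Ioi 0) := by
  have h1 := (integrableOn_rpow_mul_exp_neg_mul_rpow (p := 1) hr one_pos hs).const_mul C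
  refine Integrable.mono' h1 (ContinuousOn.aestronglyMeasurable
    (ContinuousOn.mul (by fun_prop) hf) measurableSet_Ioi) ?_
  filter_upwards [ae_restrict_mem measurableSet_Ioi] with x hx
  rw [norm_mul, norm_real, Real.norm_of_nonneg (Real.exp_pos _).le, Real.rpow_one, neg_mul]
  calc _ ≤ Real.exp (-(s * x)) * (C * x ^ r) := by gcongr; exact hC x hx
    _ = _ := by ring

namespace IsBesselPair

variable {a c : ℂ} {H P : ℝ → ℂ}

lemma continuousOn_snd (hB : IsBesselPair a c H P) : ContinuousOn P (Ioi 0) := fun x hx =>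
  (hB.hasDerivAt_snd x hx).continuousAt.continuousWithinAt

lemma intervalIntegrable (hB : IsBesselPair a c H P) {t : ℝ} (ht : 0 ≤ t) :
    IntervalIntegrable H volume 0 t := by
  obtain ⟨C, -, hC⟩ := hB.exists_norm_le
  have h1 : IntervalIntegrable (fun x : ℝ => C * x ^ (-(1 / 2) : ℝ)) volume 0 t :=
    (intervalIntegral.intervalIntegrable_rpow' (by norm_num)).const_mul C
  rw [intervalIntegrable_iff_integrableOn_Ioc_of_le ht] at h1 ⊢
  refine Integrable.mono' h1 ((hB.continuousOn.mono fun x hx => hx.1).aestronglyMeasurable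
    measurableSet_Ioc) ?_
  filter_upwards [ae_restrict_mem measurableSet_Ioc] with x hx using hC x hx.1

lemma exists_tendsto_integral (hB : IsBesselPair a c H P) :
    ∃ l, Tendsto (fun t : ℝ => ∫ x in (0 : ℝ)..t, H x) atTop (𝓝 l) := by
  obtain ⟨C, hC, h⟩ := hB.exists_norm_le_of_one_le
  have hint : IntegrableOn (fun x : ℝ => P x / (x : ℂ) ^ 2) (Ioi 1) := by
    refine Integrable.mono' ((integrableOn_Ioi_rpow_of_lt (a := -(3 / 2)) (by norm_num)
      one_pos).const_mul C) (ContinuousOn.aestronglyMeasurable (ContinuousOn.div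
        (hB.continuousOn_snd.mono (Ioi_subset_Ioi zero_le_one)) (by fun_prop) fun x hx => ?_)
        measurableSet_Ioi) ?_
    · have : (0 : ℝ) < x := zero_lt_one.trans hx
      exact pow_ne_zero 2 (ofReal_ne_zero.2 this.ne')
    · filter_upwards [ae_restrict_mem measurableSet_Ioi] with x hx
      have hx0 : (0 : ℝ) < x := zero_lt_one.trans hx
      rw [norm_div, norm_pow, norm_real, Real.norm_of_nonneg hx0.le, div_le_iff₀ (by positivity),
        mul_assoc, ← Real.rpow_natCast x 2, ← Real.rpow_add hx0]
      norm_num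
      simpa using (h x (mem_Ioi.1 hx).le).2
  have hlim := intervalIntegral_tendsto_integral_Ioi 1 hint tendsto_id
  have hPlim : Tendsto (fun t : ℝ => P t / t) atTop (𝓝 0) := by
    have h0 : Tendsto (fun t : ℝ => C * t ^ (-(1 / 2) : ℝ)) atTop (𝓝 0) := by
      simpa using (tendsto_rpow_neg_atTop (y := 1 / 2) (by norm_num)).const_mul C
    refine squeeze_zero_norm' ?_ h0
    filter_upwards [eventually_ge_atTop 1] with x hx
    have hx0 : 0 < x := by linarith
    rw [norm_div, norm_real, Real.norm_of_nonneg hx0.le, div_le_iff₀ hx0]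
    refine (h x hx).2.trans_eq ?_
    rw [mul_assoc]
    congr 1
    nth_rewrite 3 [← Real.rpow_one x]
    rw [← Real.rpow_add hx0]
    norm_num
  refine ⟨(∫ x in (0 : ℝ)..1, H x) + (P 1 - 0 - ∫ x in Ioi 1, P x / (x : ℂ) ^ 2), ?_⟩
  refine (((tendsto_const_nhds (x := P 1)).sub hPlim).sub hlim).const_add _ |>.congr' ?_
  filter_upwards [eventually_ge_atTop 1] with t ht
  have ht0 : 0 < t := by linarith
  have hsub : uIcc 1 t ⊆ Ioi 0 := by
    rw [uIcc_of_le ht]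
    exact fun x hx => lt_of_lt_of_le one_pos hx.1
  have i1 : IntervalIntegrable H volume 1 t :=
    (hB.continuousOn.mono hsub).intervalIntegrable
  have i2 : IntervalIntegrable (fun x : ℝ => P x / (x : ℂ) ^ 2) volume 1 t :=
    ContinuousOn.intervalIntegrable (ContinuousOn.div (hB.continuousOn_snd.mono hsub)
      (by fun_prop) fun x hx => pow_ne_zero 2 (ofReal_ne_zero.2 (ne_of_gt (hsub hx))))
  have hFTC : ∫ x in (1 : ℝ)..t, (H x + P x / (x : ℂ) ^ 2) = -(P t / t) - -(P 1 / (1 : ℝ)) := by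
    refine intervalIntegral.integral_eq_sub_of_hasDerivAt (f := fun x : ℝ => -(P x / x))
      (fun x hx => ?_) (i1.add i2)
    have hx0 : (x : ℂ) ≠ 0 := ofReal_ne_zero.2 (ne_of_gt (hsub hx))
    refine (((hB.hasDerivAt_snd x (hsub hx)).div (hasDerivAt_id x).ofReal_comp hx0).neg).congr_deriv ?_
    simp
    field_simp
    ring
  rw [intervalIntegral.integral_add i1 i2] at hFTC
  rw [← intervalIntegral.integral_add_adjacent_intervals (hB.intervalIntegrable zero_le_one) i1]
  simp only [id, ofReal_one, div_one] at hFTC ⊢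
  linear_combination -hFTC

end IsBesselPair

lemma hasDerivAt_exp_neg_mul (s x : ℝ) :
    HasDerivAt (fun x : ℝ => (Real.exp (-(s * x)) : ℂ)) (-s * Real.exp (-(s * x)) : ℂ) x := by
  have h : HasDerivAt (fun x : ℝ => -(s * x)) (-s) x := by
    simpa using (hasDerivAt_id x).const_mul (-s)
  refine h.exp.ofReal_comp.congr_deriv ?_
  push_cast
  ring

namespace IsBesselPair

variable {a c : ℂ} {H P : ℝ → ℂ}

lemma hasDerivAt_primitive (hB : IsBesselPair a c H P) {t : ℝ} (ht : 0 < t) :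
    HasDerivAt (fun t : ℝ => ∫ x in (0 : ℝ)..t, H x) (H t) t :=
  intervalIntegral.integral_hasDerivAt_right (hB.intervalIntegrable ht.le)
    (hB.continuousOn.stronglyMeasurableAtFilter isOpen_Ioi t ht)
    (hB.hasDerivAt_fst t ht).continuousAt

lemma tendsto_primitive_zero (hB : IsBesselPair a c H P) :
    Tendsto (fun t : ℝ => ∫ x in (0 : ℝ)..t, H x) (𝓝[>] 0) (𝓝 0) := by
  have h := intervalIntegral.continuousOn_primitive_interval
    ((intervalIntegrable_iff' (μ := volume)).1 (hB.intervalIntegrable zero_le_one))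
  have h0 := (h 0 left_mem_uIcc).tendsto
  rw [intervalIntegral.integral_same, uIcc_of_le zero_le_one] at h0
  exact h0.mono_left (nhdsWithin_le_of_mem (Icc_mem_nhdsGT one_pos))

lemma exists_norm_primitive_le (hB : IsBesselPair a c H P) :
    ∃ C, 0 < C ∧ ∀ t, 0 < t → ‖∫ x in (0 : ℝ)..t, H x‖ ≤ C := by
  obtain ⟨l, hl⟩ := hB.exists_tendsto_integral
  exact exists_norm_le_of_tendsto_zero_of_eventually_le (B := ‖l‖ + 1)
    (fun t ht => (hB.hasDerivAt_primitive ht).continuousAt.continuousWithinAt)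
    hB.tendsto_primitive_zero (hl.norm.eventually (ge_mem_nhds (by linarith)))

lemma integrableOn_laplace (hB : IsBesselPair a c H P) {s : ℝ} (hs : 0 < s) :
    IntegrableOn (fun x : ℝ => (Real.exp (-(s * x)) : ℂ) * H x) (Ioi 0) := by
  obtain ⟨C, -, hC⟩ := hB.exists_norm_le
  exact integrableOn_exp_neg_mul_of_norm_le hB.continuousOn (by norm_num) hs hC

lemma integrableOn_laplace_mul_self (hB : IsBesselPair a c H P) {s : ℝ} (hs : 0 < s) :
    IntegrableOn (fun x : ℝ => (Real.exp (-(s * x)) : ℂ) * (x * H x)) (Ioi 0) := by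
  obtain ⟨C, -, hC⟩ := hB.exists_norm_le
  refine integrableOn_exp_neg_mul_of_norm_le (C := C) (r := 1 / 2)
    (ContinuousOn.mul (by fun_prop) hB.continuousOn) (by norm_num) hs fun x hx => ?_
  rw [norm_mul, norm_real, Real.norm_of_nonneg hx.le]
  calc x * ‖H x‖ ≤ x * (C * x ^ (-(1 / 2) : ℝ)) := by gcongr; exact hC x hx
    _ = C * (x ^ (1 : ℝ) * x ^ (-(1 / 2) : ℝ)) := by rw [Real.rpow_one]; ring
    _ = C * x ^ (1 / 2 : ℝ) := by rw [← Real.rpow_add hx]; norm_num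

/-- The Laplace transform of `H` at `s` is the integral of a rescaled primitive of `H`. -/
lemma laplace_eq_integral_primitive (hB : IsBesselPair a c H P) {s : ℝ} (hs : 0 < s) :
    ∫ x in Ioi (0 : ℝ), (Real.exp (-(s * x)) : ℂ) * H x =
      ∫ u in Ioi (0 : ℝ), (Real.exp (-u) : ℂ) * ∫ x in (0 : ℝ)..s⁻¹ * u, H x := by
  obtain ⟨C, -, hC⟩ := hB.exists_norm_primitive_le
  set F : ℝ → ℂ := fun t => ∫ x in (0 : ℝ)..t, H x with hF
  have hFc : ContinuousOn F (Ioi 0) := fun t ht =>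
    (hB.hasDerivAt_primitive ht).continuousAt.continuousWithinAt
  have hi1 : IntegrableOn (fun x : ℝ => (Real.exp (-(s * x)) : ℂ) * F x) (Ioi 0) :=
    integrableOn_exp_neg_mul_of_norm_le (C := C) (r := 0) hFc (by norm_num) hs
      (by simpa using hC)
  have hi2 := hB.integrableOn_laplace hs
  have hsx : Tendsto (fun x : ℝ => s * x) atTop atTop := tendsto_id.const_mul_atTop hs
  have hexp : Tendsto (fun x : ℝ => Real.exp (-(s * x))) atTop (𝓝 0) :=
    Real.tendsto_exp_neg_atTop_nhds_zero.comp hsx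
  have key := integral_Ioi_deriv_mul_eq_sub (a := (0 : ℝ)) (a' := (0 : ℂ)) (b' := (0 : ℂ))
    (u := fun x : ℝ => (Real.exp (-(s * x)) : ℂ)) (v := F) (v' := H)
    (u' := fun x : ℝ => (-s * Real.exp (-(s * x)) : ℂ))
    (fun x _ => hasDerivAt_exp_neg_mul s x) (fun x hx => hB.hasDerivAt_primitive hx)
    (by
      refine ((hi1.const_mul (-s : ℂ)).add hi2).congr (Eventually.of_forall fun x => ?_)
      simp [mul_assoc])
    (by
      have h1 : Tendsto (fun x : ℝ => (Real.exp (-(s * x)) : ℂ)) (𝓝[>] 0)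
          (𝓝 (Real.exp (-(s * 0)) : ℂ)) :=
        (Continuous.tendsto (by fun_prop) 0).mono_left nhdsWithin_le_nhds
      simpa [Pi.mul_def] using h1.mul hB.tendsto_primitive_zero)
    (by
      refine squeeze_zero_norm' ?_ (by simpa using hexp.mul_const C)
      filter_upwards [eventually_gt_atTop 0] with x hx
      rw [Pi.mul_apply, norm_mul, norm_real, Real.norm_of_nonneg (Real.exp_pos _).le]
      gcongr
      exact hC x hx)
  have hsub := integral_comp_mul_left_Ioi (fun u : ℝ => (Real.exp (-u) : ℂ) * F (s⁻¹ * u)) 0 hs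
  simp only [mul_zero, inv_mul_cancel_left₀ hs.ne', real_smul] at hsub
  have hs' : (s : ℂ) ≠ 0 := ofReal_ne_zero.2 hs.ne'
  have e : ∫ x in Ioi (0 : ℝ), (-s * Real.exp (-(s * x)) * F x + Real.exp (-(s * x)) * H x : ℂ) =
      -s * (∫ x in Ioi (0 : ℝ), Real.exp (-(s * x)) * F x) +
      ∫ x in Ioi (0 : ℝ), (Real.exp (-(s * x)) : ℂ) * H x := by
    rw [← integral_const_mul, ← integral_add (hi1.const_mul _) hi2]
    simp only [mul_assoc]
  rw [e, hsub, ofReal_inv] at key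
  change _ = ∫ u in Ioi (0 : ℝ), (Real.exp (-u) : ℂ) * F (s⁻¹ * u)
  linear_combination key + (∫ u in Ioi (0 : ℝ), (Real.exp (-u) : ℂ) * F (s⁻¹ * u)) *
    mul_inv_cancel₀ hs'

/-- Abel summation for the integral of `H`. -/
lemma tendsto_laplace_zero (hB : IsBesselPair a c H P) {l : ℂ}
    (hl : Tendsto (fun t : ℝ => ∫ x in (0 : ℝ)..t, H x) atTop (𝓝 l)) :
    Tendsto (fun s : ℝ => ∫ x in Ioi (0 : ℝ), (Real.exp (-(s * x)) : ℂ) * H x)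
      (𝓝[>] 0) (𝓝 l) := by
  obtain ⟨C, -, hC⟩ := hB.exists_norm_primitive_le
  have e : l = ∫ u in Ioi (0 : ℝ), (Real.exp (-u) : ℂ) * l := by
    rw [integral_mul_const, integral_complex_ofReal, integral_exp_neg_Ioi_zero]
    simp
  rw [e]
  have : Tendsto (fun s : ℝ => ∫ u in Ioi (0 : ℝ),
      (Real.exp (-u) : ℂ) * ∫ x in (0 : ℝ)..s⁻¹ * u, H x) (𝓝[>] 0)
      (𝓝 (∫ u in Ioi (0 : ℝ), (Real.exp (-u) : ℂ) * l)) := by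
    refine tendsto_integral_filter_of_dominated_convergence (fun u => Real.exp (-u) * C) ?_ ?_ ?_ ?_
    · filter_upwards [self_mem_nhdsWithin] with s hs
      refine ContinuousOn.aestronglyMeasurable (ContinuousOn.mul (by fun_prop) fun u hu => ?_)
        measurableSet_Ioi
      have hsu : 0 < s⁻¹ * u := mul_pos (inv_pos.2 hs) hu
      exact (ContinuousAt.comp (g := fun t : ℝ => ∫ x in (0 : ℝ)..t, H x)
        (f := fun u : ℝ => s⁻¹ * u) (hB.hasDerivAt_primitive hsu).continuousAt
        (by fun_prop)).continuousWithinAt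
    · filter_upwards [self_mem_nhdsWithin] with s hs
      filter_upwards [ae_restrict_mem measurableSet_Ioi] with u hu
      rw [norm_mul, norm_real, Real.norm_of_nonneg (Real.exp_pos _).le]
      gcongr
      exact hC _ (mul_pos (inv_pos.2 hs) hu)
    · exact (integrableOn_exp_neg_Ioi 0).mul_const C
    · filter_upwards [ae_restrict_mem measurableSet_Ioi] with u hu
      exact (hl.comp (tendsto_inv_nhdsGT_zero.atTop_mul_const hu)).const_mul _
  refine this.congr' ?_
  filter_upwards [self_mem_nhdsWithin] with s hs
  exact (hB.laplace_eq_integral_primitive hs).symm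

/-- The differential equation for the Laplace transform in integrated form. -/
lemma integral_laplace_eq (hB : IsBesselPair a c H P) {s : ℝ} (hs : 0 < s) :
    s * (∫ x in Ioi (0 : ℝ), (Real.exp (-(s * x)) : ℂ) * H x) -
      (1 + s ^ 2) * (∫ x in Ioi (0 : ℝ), (Real.exp (-(s * x)) : ℂ) * (x * H x)) = -c := by
  have hi1 := hB.integrableOn_laplace hs
  have hi2 := hB.integrableOn_laplace_mul_self hs
  obtain ⟨C, hC, hb⟩ := hB.exists_norm_le_of_one_le
  have key := integral_Ioi_deriv_mul_eq_sub (a := (0 : ℝ)) (a' := c) (b' := (0 : ℂ))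
    (u := fun x : ℝ => (Real.exp (-(s * x)) : ℂ)) (v := fun x => P x + s * (x * H x))
    (v' := fun x => -(x * H x) + s * (H x + P x))
    (u' := fun x : ℝ => (-s * Real.exp (-(s * x)) : ℂ))
    (fun x _ => hasDerivAt_exp_neg_mul s x) (fun x hx => by
      have hx0 : (x : ℂ) ≠ 0 := ofReal_ne_zero.2 (ne_of_gt hx)
      refine ((hB.hasDerivAt_snd x hx).add
        (((hasDerivAt_id x).ofReal_comp.mul (hB.hasDerivAt_fst x hx)).const_mul _)).congr_deriv ?_
      simp only [id, ofReal_one, one_mul, mul_div_cancel₀ _ hx0])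
    (by
      refine ((hi1.const_mul (s : ℂ)).sub (hi2.const_mul (1 + s ^ 2 : ℂ))).congr
        (Eventually.of_forall fun x => ?_)
      simp
      ring)
    (by
      have h1 : Tendsto (fun x : ℝ => (Real.exp (-(s * x)) : ℂ)) (𝓝[>] 0)
          (𝓝 (Real.exp (-(s * 0)) : ℂ)) :=
        (Continuous.tendsto (by fun_prop) 0).mono_left nhdsWithin_le_nhds
      have h2 := hB.tendsto_rpow_mul one_pos
      simp only [Real.rpow_one] at h2
      simpa [Pi.mul_def] using h1.mul (hB.tendsto_snd.add (h2.const_mul (s : ℂ))))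
    (by
      have h0 : Tendsto (fun x : ℝ => C * (1 + s) * (x ^ (1 / 2 : ℝ) * Real.exp (-s * x))) atTop
          (𝓝 0) := by
        simpa using (tendsto_rpow_mul_exp_neg_mul_atTop_nhds_zero (1 / 2) s hs).const_mul
          (C * (1 + s))
      refine squeeze_zero_norm' ?_ h0
      filter_upwards [eventually_ge_atTop 1] with x hx
      have hx0 : 0 < x := by linarith
      have h3 : x * x ^ (-(1 / 2) : ℝ) = x ^ (1 / 2 : ℝ) := by
        nth_rewrite 1 [← Real.rpow_one x]
        rw [← Real.rpow_add hx0]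
        norm_num
      have h4 : ‖P x + s * (x * H x)‖ ≤ C * x ^ (1 / 2 : ℝ) + s * (x * (C * x ^ (-(1 / 2) : ℝ))) := by
        refine (norm_add_le _ _).trans ?_
        rw [norm_mul, norm_mul, norm_real, norm_real, Real.norm_of_nonneg hs.le,
          Real.norm_of_nonneg hx0.le]
        gcongr
        exacts [(hb x hx).2, (hb x hx).1]
      rw [Pi.mul_apply, norm_mul, norm_real, Real.norm_of_nonneg (Real.exp_pos _).le]
      calc _ ≤ Real.exp (-(s * x)) *
            (C * x ^ (1 / 2 : ℝ) + s * (x * (C * x ^ (-(1 / 2) : ℝ)))) := by gcongr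
        _ = Real.exp (-(s * x)) * (C * x ^ (1 / 2 : ℝ) + s * C * (x * x ^ (-(1 / 2) : ℝ))) := by
          ring
        _ = _ := by rw [h3, neg_mul]; ring)
  rw [← integral_const_mul, ← integral_const_mul,
    ← integral_sub (hi1.const_mul _) (hi2.const_mul _)]
  rw [zero_sub] at key
  rw [← key]
  congr 1 with x
  ring

lemma hasDerivAt_laplace (hB : IsBesselPair a c H P) {s : ℝ} (hs : 0 < s) :
    HasDerivAt (fun s : ℝ => ∫ x in Ioi (0 : ℝ), (Real.exp (-(s * x)) : ℂ) * H x)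
      (-∫ x in Ioi (0 : ℝ), (Real.exp (-(s * x)) : ℂ) * (x * H x)) s := by
  have h := hasDerivAt_integral_of_dominated_loc_of_deriv_le (μ := volume.restrict (Ioi (0 : ℝ)))
    (F := fun (s : ℝ) (x : ℝ) => (Real.exp (-(s * x)) : ℂ) * H x)
    (F' := fun (s : ℝ) (x : ℝ) => -((Real.exp (-(s * x)) : ℂ) * (x * H x)))
    (bound := fun x => ‖(Real.exp (-(s / 2 * x)) : ℂ) * (x * H x)‖)
    (Ioi_mem_nhds (half_lt_self hs))
    (by
      filter_upwards [Ioi_mem_nhds hs] with t ht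
      exact (hB.integrableOn_laplace ht).aestronglyMeasurable)
    (hB.integrableOn_laplace hs) (hB.integrableOn_laplace_mul_self hs).neg.aestronglyMeasurable
    (by
      filter_upwards [ae_restrict_mem measurableSet_Ioi] with x hx t ht
      have hx0 : (0 : ℝ) < x := hx
      have ht0 : s / 2 < t := ht
      rw [norm_neg, norm_mul, norm_mul (_ : ℂ) (_ * _), norm_real, norm_real,
        Real.norm_of_nonneg (Real.exp_pos _).le, Real.norm_of_nonneg (Real.exp_pos _).le]
      gcongr)
    (hB.integrableOn_laplace_mul_self (half_pos hs)).norm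
    (by
      refine Eventually.of_forall fun x t _ => ?_
      have h1 := (hasDerivAt_exp_neg_mul x t).mul_const (H x)
      simp only [mul_comm x] at h1
      refine h1.congr_deriv ?_
      ring)
  refine h.2.congr_deriv ?_
  rw [integral_neg]

end IsBesselPair

lemma integral_exp_neg_mul_log :
    ∫ u in Ioi (0 : ℝ), (Real.exp (-u) : ℂ) * Real.log u = -Real.eulerMascheroniConstant := by
  have h1 := hasDerivAt_GammaIntegral (s := 1) (by simp)
  have h2 : Complex.Gamma =ᶠ[𝓝 1] Complex.GammaIntegral := by
    filter_upwards [(isOpen_lt continuous_const continuous_re).mem_nhds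
      (show (0 : ℝ) < (1 : ℂ).re by simp)] with s hs using Complex.Gamma_eq_integral hs
  rw [← (h1.congr_of_eventuallyEq h2).unique Complex.hasDerivAt_Gamma_one]
  congr 1 with u
  simp [mul_comm]

lemma integrableOn_exp_neg_mul_log :
    IntegrableOn (fun u : ℝ => (Real.exp (-u) : ℂ) * Real.log u) (Ioi 0) := by
  by_contra h
  have h1 := integral_exp_neg_mul_log
  rw [integral_undef h, eq_comm, neg_eq_zero, ofReal_eq_zero] at h1
  linarith [Real.one_half_lt_eulerMascheroniConstant]

lemma integrableOn_exp_neg_complex : IntegrableOn (fun u : ℝ => (Real.exp (-u) : ℂ)) (Ioi 0) :=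
  (integrableOn_exp_neg_Ioi 0).ofReal

lemma integral_exp_neg_complex : ∫ u in Ioi (0 : ℝ), (Real.exp (-u) : ℂ) = 1 := by
  rw [integral_complex_ofReal, integral_exp_neg_Ioi_zero, ofReal_one]

lemma sqrt_one_add_sq_div_mem {s : ℝ} (hs : 0 < s) :
    0 ≤ √(1 + s ^ 2) / s - 1 ∧ √(1 + s ^ 2) / s - 1 ≤ s⁻¹ := by
  have h1 : s ≤ √(1 + s ^ 2) := Real.le_sqrt_of_sq_le (by linarith)
  have h2 : √(1 + s ^ 2) ≤ s + 1 := by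
    rw [Real.sqrt_le_left (by positivity)]
    nlinarith
  constructor
  · rw [sub_nonneg, le_div_iff₀ hs]
    linarith
  · rw [sub_le_iff_le_add, div_le_iff₀ hs, add_mul, inv_mul_cancel₀ hs.ne']
    linarith

lemma tendsto_sqrt_one_add_sq_div : Tendsto (fun s : ℝ => √(1 + s ^ 2) / s) atTop (𝓝 1) := by
  have h : Tendsto (fun s : ℝ => √(1 + s ^ 2) / s - 1) atTop (𝓝 0) := by
    refine squeeze_zero' ?_ ?_ tendsto_inv_atTop_zero
    all_goals filter_upwards [eventually_gt_atTop 0] with s hs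
    exacts [(sqrt_one_add_sq_div_mem hs).1, (sqrt_one_add_sq_div_mem hs).2]
  simpa using h.add_const 1

lemma tendsto_sqrt_one_add_sq_div_sub_one_mul_log :
    Tendsto (fun s : ℝ => (√(1 + s ^ 2) / s - 1) * Real.log s) atTop (𝓝 0) := by
  refine squeeze_zero' ?_ ?_ (Real.isLittleO_log_id_atTop.tendsto_div_nhds_zero)
  all_goals
    filter_upwards [eventually_ge_atTop 1] with s hs
    have h := sqrt_one_add_sq_div_mem (s := s) (by linarith)
    have h' := Real.log_nonneg hs
  · exact mul_nonneg h.1 h'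
  · rw [id, div_eq_inv_mul (Real.log s)]
    exact mul_le_mul_of_nonneg_right h.2 h'

lemma tendsto_arsinh_sub_log :
    Tendsto (fun s : ℝ => Real.arsinh s - Real.log s) atTop (𝓝 (Real.log 2)) := by
  have h := (tendsto_sqrt_one_add_sq_div.const_add 1).log (by norm_num)
  rw [one_add_one_eq_two] at h
  refine h.congr' ?_
  filter_upwards [eventually_gt_atTop 0] with s hs
  rw [Real.arsinh, ← Real.log_div (by positivity) hs.ne', add_div, div_self hs.ne']

namespace IsBesselPair

variable {a c : ℂ} {H P : ℝ → ℂ}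

lemma exists_norm_sub_le (hB : IsBesselPair a c H P) : ∃ C, 0 < C ∧ ∀ x : ℝ, 0 < x →
    ‖H x - (a + c * Real.log x)‖ ≤ C * (1 + x) := by
  obtain ⟨C, hC, hb⟩ := hB.exists_norm_le
  have hlogc : ContinuousOn (fun x : ℝ => (Real.log x : ℂ)) (Ioi 0) :=
    continuous_ofReal.comp_continuousOn (Real.continuousOn_log.mono fun x hx => ne_of_gt hx)
  have hne : ∀ x : ℝ, 0 < x → (1 + x : ℂ) ≠ 0 := fun x hx => by
    exact_mod_cast (by positivity : (1 + x : ℝ) ≠ 0)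
  have aux : ∀ x : ℝ, 0 < x → ‖(1 + x : ℂ)‖ = 1 + x := fun x hx => by
    rw [← ofReal_one, ← ofReal_add, norm_real, Real.norm_of_nonneg (by positivity)]
  obtain ⟨K, hK, h⟩ := exists_norm_le_of_tendsto_zero_of_eventually_le
    (f := fun x : ℝ => (H x - (a + c * Real.log x)) / (1 + x)) (l := 0) (B := C + ‖a‖ + ‖c‖)
    (ContinuousOn.div (hB.continuousOn.sub (continuousOn_const.add (continuousOn_const.mul hlogc)))
      (by fun_prop) hne)
    (by
      have h1 : Tendsto (fun x : ℝ => (1 + x : ℂ)) (𝓝[>] 0) (𝓝 (1 + (0 : ℝ))) :=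
        (Continuous.tendsto (by fun_prop) 0).mono_left nhdsWithin_le_nhds
      simpa [Pi.div_def] using hB.tendsto_fst.div h1 (by simp))
    (by
      filter_upwards [eventually_ge_atTop 1] with x hx
      have hx0 : 0 < x := by linarith
      rw [norm_div, aux x hx0, div_le_iff₀ (by positivity)]
      have h1 : ‖H x‖ ≤ C * (1 + x) := (hb x hx0).trans (by
        gcongr
        exact (Real.rpow_le_one_of_one_le_of_nonpos hx (by norm_num)).trans (by linarith))
      have h2 : ‖(Real.log x : ℂ)‖ ≤ 1 + x := by
        rw [norm_real, Real.norm_of_nonneg (Real.log_nonneg hx)]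
        linarith [Real.log_le_sub_one_of_pos hx0]
      have h3 : ‖a‖ ≤ ‖a‖ * (1 + x) := le_mul_of_one_le_right (norm_nonneg _) (by linarith)
      calc _ ≤ ‖H x‖ + (‖a‖ + ‖c‖ * ‖(Real.log x : ℂ)‖) := by
            refine (norm_sub_le _ _).trans ?_
            gcongr
            refine (norm_add_le _ _).trans ?_
            rw [norm_mul]
        _ ≤ C * (1 + x) + (‖a‖ * (1 + x) + ‖c‖ * (1 + x)) := by gcongr
        _ = _ := by ring)
  refine ⟨K, hK, fun x hx => ?_⟩
  have := h x hx
  rwa [norm_div, aux x hx, div_le_iff₀ (by positivity)] at this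

lemma tendsto_laplace_atTop (hB : IsBesselPair a c H P) :
    Tendsto (fun s : ℝ => s * (∫ x in Ioi (0 : ℝ), (Real.exp (-(s * x)) : ℂ) * H x) -
      (a - c * Real.eulerMascheroniConstant - c * Real.log s)) atTop (𝓝 0) := by
  obtain ⟨C, hC, hb⟩ := hB.exists_norm_sub_le
  set E : ℝ → ℂ := fun x => H x - (a + c * Real.log x) with hE
  have hEc : ContinuousOn E (Ioi 0) := hB.continuousOn.sub (continuousOn_const.add
    (continuousOn_const.mul (continuous_ofReal.comp_continuousOn
      (Real.continuousOn_log.mono fun x hx => ne_of_gt hx))))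
  have hEm : ∀ s : ℝ, 0 < s → AEStronglyMeasurable
      (fun u : ℝ => (Real.exp (-u) : ℂ) * E (s⁻¹ * u)) (volume.restrict (Ioi 0)) := fun s hs =>
    ContinuousOn.aestronglyMeasurable (ContinuousOn.mul (by fun_prop)
      (hEc.comp (by fun_prop) fun u hu => mul_pos (inv_pos.2 hs) hu)) measurableSet_Ioi
  have hEb : ∀ s : ℝ, 1 ≤ s → ∀ u : ℝ, 0 < u →
      ‖(Real.exp (-u) : ℂ) * E (s⁻¹ * u)‖ ≤ C * (Real.exp (-u) + u ^ (1 : ℝ) *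
        Real.exp (-1 * u ^ (1 : ℝ))) := fun s hs u hu => by
    have hs0 : 0 < s := by linarith
    rw [norm_mul, norm_real, Real.norm_of_nonneg (Real.exp_pos _).le, Real.rpow_one, neg_one_mul]
    have h1 : s⁻¹ * u ≤ u := mul_le_of_le_one_left hu.le (inv_le_one_of_one_le₀ hs)
    calc _ ≤ Real.exp (-u) * (C * (1 + s⁻¹ * u)) := by
          gcongr
          exact hb _ (mul_pos (inv_pos.2 hs0) hu)
      _ ≤ Real.exp (-u) * (C * (1 + u)) := by gcongr
      _ = _ := by ring
  have hbi : IntegrableOn (fun u : ℝ => C * (Real.exp (-u) + u ^ (1 : ℝ) *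
      Real.exp (-1 * u ^ (1 : ℝ)))) (Ioi 0) :=
    ((integrableOn_exp_neg_Ioi 0).add
      (integrableOn_rpow_mul_exp_neg_mul_rpow (by norm_num) one_pos one_pos)).const_mul C
  have hEi : ∀ s : ℝ, 1 ≤ s →
      IntegrableOn (fun u : ℝ => (Real.exp (-u) : ℂ) * E (s⁻¹ * u)) (Ioi 0) := fun s hs => by
    refine Integrable.mono' hbi (hEm s (by linarith)) ?_
    filter_upwards [ae_restrict_mem measurableSet_Ioi] with u hu using hEb s hs u hu
  have hlim : Tendsto (fun s : ℝ => ∫ u in Ioi (0 : ℝ), (Real.exp (-u) : ℂ) * E (s⁻¹ * u)) atTop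
      (𝓝 (∫ u in Ioi (0 : ℝ), (Real.exp (-u) : ℂ) * 0)) := by
    refine tendsto_integral_filter_of_dominated_convergence _ ?_ ?_ hbi ?_
    · filter_upwards [eventually_gt_atTop 0] with s hs using hEm s hs
    · filter_upwards [eventually_ge_atTop 1] with s hs
      filter_upwards [ae_restrict_mem measurableSet_Ioi] with u hu using hEb s hs u hu
    · filter_upwards [ae_restrict_mem measurableSet_Ioi] with u hu
      refine (hB.tendsto_fst.comp (tendsto_nhdsWithin_iff.2 ⟨?_, ?_⟩)).const_mul _
      · simpa using tendsto_inv_atTop_zero.mul_const u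
      · filter_upwards [eventually_gt_atTop 0] with s hs using mul_pos (inv_pos.2 hs) hu
  simp only [mul_zero, integral_zero] at hlim
  refine hlim.congr' ?_
  filter_upwards [eventually_ge_atTop 1] with s hs
  have hs0 : 0 < s := by linarith
  have hsub := integral_comp_mul_left_Ioi (fun u : ℝ => (Real.exp (-u) : ℂ) * H (s⁻¹ * u)) 0 hs0
  simp only [mul_zero, inv_mul_cancel_left₀ hs0.ne', real_smul, ofReal_inv] at hsub
  rw [hsub, mul_inv_cancel_left₀ (ofReal_ne_zero.2 hs0.ne'), eq_sub_iff_add_eq]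
  have hi : IntegrableOn (fun u : ℝ => (Real.exp (-u) : ℂ) * (a - c * Real.log s) +
      (Real.exp (-u) : ℂ) * Real.log u * c) (Ioi 0) :=
    (integrableOn_exp_neg_complex.mul_const _).add (integrableOn_exp_neg_mul_log.mul_const _)
  have e : a - c * Real.eulerMascheroniConstant - c * Real.log s =
      ∫ u in Ioi (0 : ℝ), ((Real.exp (-u) : ℂ) * (a - c * Real.log s) +
        (Real.exp (-u) : ℂ) * Real.log u * c) := by
    rw [integral_add (integrableOn_exp_neg_complex.mul_const _)
      (integrableOn_exp_neg_mul_log.mul_const _), integral_mul_const, integral_mul_const,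
      integral_exp_neg_mul_log, integral_exp_neg_complex]
    ring
  rw [e, ← integral_add (hEi s hs) hi]
  refine setIntegral_congr_fun measurableSet_Ioi fun u hu => ?_
  have hu0 : u ≠ 0 := ne_of_gt hu
  simp only [hE, Real.log_mul (inv_ne_zero hs0.ne') hu0, Real.log_inv]
  push_cast
  ring

/-- The solution of the differential equation for the Laplace transform. -/
lemma sqrt_mul_laplace_add (hB : IsBesselPair a c H P) {l : ℂ}
    (hl : Tendsto (fun t : ℝ => ∫ x in (0 : ℝ)..t, H x) atTop (𝓝 l)) {s : ℝ} (hs : 0 < s) :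
    (√(1 + s ^ 2) : ℂ) * (∫ x in Ioi (0 : ℝ), (Real.exp (-(s * x)) : ℂ) * H x) +
      c * Real.arsinh s = l := by
  set Φ : ℝ → ℂ := fun s => (√(1 + s ^ 2) : ℂ) *
    (∫ x in Ioi (0 : ℝ), (Real.exp (-(s * x)) : ℂ) * H x) + c * Real.arsinh s with hΦ
  have hd : ∀ s : ℝ, 0 < s → HasDerivAt Φ 0 s := fun s hs => by
    have hq : 0 < 1 + s ^ 2 := by positivity
    have h1 : HasDerivAt (fun s : ℝ => √(1 + s ^ 2)) (s / √(1 + s ^ 2)) s := by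
      have := (((hasDerivAt_pow 2 s).const_add 1).sqrt hq.ne')
      refine this.congr_deriv ?_
      field_simp
      simp
    refine ((h1.ofReal_comp.mul (hB.hasDerivAt_laplace hs)).add
      ((Real.hasDerivAt_arsinh s).ofReal_comp.const_mul c)).congr_deriv ?_
    have h2 := hB.integral_laplace_eq hs
    have h3 : (√(1 + s ^ 2) : ℂ) ^ 2 = 1 + s ^ 2 := by
      rw [← ofReal_pow, Real.sq_sqrt hq.le]
      push_cast
      rfl
    have h4 : (√(1 + s ^ 2) : ℂ) ≠ 0 := ofReal_ne_zero.2 (Real.sqrt_pos.2 hq).ne'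
    rw [ofReal_div, ofReal_inv]
    rw [← h3] at h2
    generalize (√(1 + s ^ 2) : ℂ) = w at *
    generalize (∫ x in Ioi (0 : ℝ), (Real.exp (-(s * x)) : ℂ) * H x) = L at *
    generalize (∫ x in Ioi (0 : ℝ), (Real.exp (-(s * x)) : ℂ) * (x * H x)) = M at *
    field_simp
    linear_combination h2
  have hconst : ∀ t : ℝ, 0 < t → Φ t = Φ s := fun t ht =>
    isOpen_Ioi.is_const_of_deriv_eq_zero isPreconnected_Ioi
      (fun x hx => (hd x hx).differentiableAt.differentiableWithinAt)
      (fun x hx => (hd x hx).deriv) (mem_Ioi.2 ht) (mem_Ioi.2 hs)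
  have hlim : Tendsto Φ (𝓝[>] 0) (𝓝 l) := by
    have h1 : Tendsto (fun s : ℝ => (√(1 + s ^ 2) : ℂ)) (𝓝[>] 0) (𝓝 (√(1 + 0 ^ 2) : ℝ)) :=
      (Continuous.tendsto (by fun_prop) 0).mono_left nhdsWithin_le_nhds
    have h2 : Tendsto (fun s : ℝ => (Real.arsinh s : ℂ)) (𝓝[>] 0) (𝓝 (Real.arsinh 0 : ℝ)) :=
      ((continuous_ofReal.comp Real.continuous_arsinh).tendsto 0).mono_left nhdsWithin_le_nhds
    simpa [hΦ] using (h1.mul (hB.tendsto_laplace_zero hl)).add (h2.const_mul c)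
  refine tendsto_nhds_unique (tendsto_const_nhds.congr' ?_) hlim
  filter_upwards [self_mem_nhdsWithin] with t ht using (hconst t ht).symm

theorem tendsto_integral (hB : IsBesselPair a c H P) :
    Tendsto (fun t : ℝ => ∫ x in (0 : ℝ)..t, H x) atTop
      (𝓝 (a - c * Real.eulerMascheroniConstant + c * Real.log 2)) := by
  obtain ⟨l, hl⟩ := hB.exists_tendsto_integral
  convert hl using 2
  set A := a - c * Real.eulerMascheroniConstant with hA
  have hr := tendsto_sqrt_one_add_sq_div.ofReal
  have h := (((hr.mul hB.tendsto_laplace_atTop).add (hr.mul_const A)).sub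
    (tendsto_sqrt_one_add_sq_div_sub_one_mul_log.ofReal.const_mul c)).add
    (tendsto_arsinh_sub_log.ofReal.const_mul c)
  simp only [ofReal_one, one_mul, mul_zero, zero_add, ofReal_zero, sub_zero] at h
  refine tendsto_nhds_unique h (tendsto_const_nhds.congr' ?_)
  filter_upwards [eventually_gt_atTop 0] with s hs
  have hs' : (s : ℂ) ≠ 0 := ofReal_ne_zero.2 hs.ne'
  rw [← hB.sqrt_mul_laplace_add hl hs, ← hA]
  push_cast
  field_simp
  ring

end IsBesselPair

open Nat

lemma tsum_mul_zero_pow (b : ℕ → ℂ) : ∑' k, b k * 0 ^ k = b 0 := by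
  rw [tsum_eq_single 0 fun k hk => by simp [hk]]
  simp

lemma summable_mul_pow_of_norm_le {b : ℕ → ℂ} {M : ℝ} (hb : ∀ k, ‖b k‖ ≤ M / k !) (q : ℂ) :
    Summable fun k => b k * q ^ k := by
  refine Summable.of_norm_bounded ((Real.summable_pow_div_factorial ‖q‖).mul_left M) fun k => ?_
  rw [norm_mul, norm_pow]
  calc _ ≤ M / k ! * ‖q‖ ^ k := by gcongr; exact hb k
    _ = _ := by ring

lemma hasDerivAt_tsum_mul_pow {b : ℕ → ℂ} {M : ℝ} (hb : ∀ k, ‖b k‖ ≤ M / k !) (q : ℂ) :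
    HasDerivAt (fun q : ℂ => ∑' k, b k * q ^ k) (∑' k : ℕ, (k + 1) * b (k + 1) * q ^ k) q := by
  set R : ℝ := ‖q‖ + 1
  have hR : 0 ≤ R := by positivity
  have hu : Summable fun k : ℕ => M / k ! * (k * R ^ (k - 1)) := by
    refine (summable_nat_add_iff 1).1 (((Real.summable_pow_div_factorial R).mul_left M).congr
      fun k => ?_)
    rw [Nat.factorial_succ, Nat.add_sub_cancel]
    push_cast
    have : (k + 1 : ℝ) ≠ 0 := by positivity
    field_simp
  have hg' : ∀ (k : ℕ) (z : ℂ), z ∈ Metric.ball (0 : ℂ) R →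
      ‖b k * (k * z ^ (k - 1))‖ ≤ M / k ! * (k * R ^ (k - 1)) := fun k z hz => by
    rw [norm_mul, norm_mul, norm_pow, norm_natCast]
    have hz : ‖z‖ ≤ R := (mem_ball_zero_iff.1 hz).le
    exact mul_le_mul (hb k) (by gcongr) (by positivity) ((norm_nonneg _).trans (hb k))
  have hq : q ∈ Metric.ball (0 : ℂ) R := mem_ball_zero_iff.2 (by simp [R])
  have h := hasDerivAt_tsum_of_isPreconnected (g := fun k z => b k * z ^ k)
    (g' := fun k z => b k * (k * z ^ (k - 1))) hu Metric.isOpen_ball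
    (convex_ball (0 : ℂ) R).isPreconnected
    (fun k z _ => (hasDerivAt_pow k z).const_mul (b k)) hg' hq (summable_mul_pow_of_norm_le hb q) hq
  refine h.congr_deriv ?_
  rw [(Summable.of_norm_bounded hu fun k => hg' k q hq).tsum_eq_zero_add]
  simp only [CharP.cast_eq_zero, zero_mul, mul_zero, zero_add, Nat.add_sub_cancel]
  refine tsum_congr fun k => ?_
  push_cast
  ring

lemma tsum_nat_mul_mul_pow {b : ℕ → ℂ} {M : ℝ} (hb : ∀ k : ℕ, ‖k * b k‖ ≤ M / k !) (q : ℂ) :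
    ∑' k : ℕ, k * b k * q ^ k = q * ∑' k : ℕ, (k + 1) * b (k + 1) * q ^ k := by
  rw [(summable_mul_pow_of_norm_le hb q).tsum_eq_zero_add, ← tsum_mul_left]
  simp only [CharP.cast_eq_zero, zero_mul, zero_add]
  refine tsum_congr fun k => ?_
  push_cast
  ring

/-- Coefficients of `J_0` as a power series in `z ^ 2`. -/
noncomputable def besselCoeff (k : ℕ) : ℂ := (-(1 / 4 : ℂ)) ^ k / (k ! * k !)

lemma besselCoeff_zero : besselCoeff 0 = 1 := by simp [besselCoeff]

lemma besselCoeff_succ (k : ℕ) :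
    (k + 1) ^ 2 * besselCoeff (k + 1) = -(1 / 4) * besselCoeff k := by
  have h1 : (k + 1 : ℂ) ≠ 0 := by exact_mod_cast k.succ_ne_zero
  have h2 : (k ! : ℂ) ≠ 0 := by exact_mod_cast k.factorial_ne_zero
  rw [besselCoeff, besselCoeff, Nat.factorial_succ, pow_succ (-(1 / 4 : ℂ))]
  push_cast
  field_simp

lemma norm_mul_besselCoeff_le {w : ℂ} {k : ℕ} (hw : ‖w‖ ≤ (k + 1) ^ 2) :
    ‖w * besselCoeff k‖ ≤ 1 / k ! := by
  have h1 : ((k : ℝ) + 1) ^ 2 ≤ 4 ^ k := by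
    have : (k : ℝ) + 1 ≤ 2 ^ k := by exact_mod_cast k.lt_two_pow_self
    calc ((k : ℝ) + 1) ^ 2 ≤ (2 ^ k) ^ 2 := by gcongr
      _ = 4 ^ k := by rw [← pow_mul, mul_comm, pow_mul]; norm_num
  have h2 : (1 : ℝ) ≤ k ! := by exact_mod_cast k.factorial_pos
  have h3 : ‖besselCoeff k‖ = 1 / (4 ^ k * (k ! * k !)) := by
    simp [besselCoeff]
    ring
  rw [norm_mul, h3, mul_one_div, div_le_div_iff₀ (by positivity) (by positivity), one_mul]
  calc ‖w‖ * (k ! : ℝ) ≤ 4 ^ k * k ! := by gcongr; exact hw.trans h1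
    _ ≤ 4 ^ k * (k ! * k !) := by gcongr; exact le_mul_of_one_le_left (by positivity) h2

lemma psiInt_one : psiInt 1 = -Real.eulerMascheroniConstant := by simp [psiInt]

lemma psiInt_succ_succ (k : ℕ) : psiInt (k + 1 + 1) = psiInt (k + 1) + 1 / (k + 1) := by
  simp [psiInt, Finset.sum_range_succ, add_assoc]

lemma abs_psiInt_succ_le (k : ℕ) : |psiInt (k + 1)| ≤ k + 1 := by
  induction k with
  | zero =>
    rw [zero_add, psiInt_one, abs_neg, abs_of_pos]
    · simpa using Real.eulerMascheroniConstant_lt_two_thirds.le.trans (by norm_num)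
    · linarith [Real.one_half_lt_eulerMascheroniConstant]
  | succ k ih =>
    rw [psiInt_succ_succ]
    refine (abs_add_le _ _).trans ?_
    have : |1 / ((k : ℝ) + 1)| ≤ 1 := by
      rw [abs_of_pos (by positivity), div_le_one (by positivity)]
      linarith [(Nat.cast_nonneg k : (0 : ℝ) ≤ k)]
    push_cast
    linarith

/-- `J_0 z` as a function of `q = z ^ 2`. -/
noncomputable def besselJSeries (q : ℂ) : ℂ := ∑' k, besselCoeff k * q ^ k

/-- The power series part of `Y_0 z`, up to a constant factor, as a function of `q = z ^ 2`. -/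
noncomputable def besselYSeries (q : ℂ) : ℂ :=
  ∑' k : ℕ, psiInt (k + 1) * besselCoeff k * q ^ k

lemma norm_besselCoeff_le (k : ℕ) : ‖besselCoeff k‖ ≤ 1 / k ! := by
  simpa using norm_mul_besselCoeff_le (w := 1) (k := k)
    (by rw [norm_one]; exact one_le_pow₀ (by linarith [(Nat.cast_nonneg k : (0 : ℝ) ≤ k)]))

lemma norm_nat_mul_besselCoeff_le (k : ℕ) : ‖k * besselCoeff k‖ ≤ 1 / k ! :=
  norm_mul_besselCoeff_le (by
    rw [norm_natCast]
    nlinarith [(Nat.cast_nonneg k : (0 : ℝ) ≤ k)])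

lemma norm_psiInt_mul_besselCoeff_le (k : ℕ) : ‖psiInt (k + 1) * besselCoeff k‖ ≤ 1 / k ! :=
  norm_mul_besselCoeff_le (by
    rw [norm_real, Real.norm_eq_abs]
    nlinarith [(Nat.cast_nonneg k : (0 : ℝ) ≤ k), abs_psiInt_succ_le k])

lemma norm_nat_mul_psiInt_mul_besselCoeff_le (k : ℕ) :
    ‖k * (psiInt (k + 1) * besselCoeff k)‖ ≤ 1 / k ! := by
  rw [← mul_assoc]
  refine norm_mul_besselCoeff_le ?_
  rw [norm_mul, norm_real, Real.norm_eq_abs, norm_natCast]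
  nlinarith [(Nat.cast_nonneg k : (0 : ℝ) ≤ k), abs_psiInt_succ_le k]

lemma hasDerivAt_besselJSeries (q : ℂ) :
    HasDerivAt besselJSeries (deriv besselJSeries q) q :=
  (hasDerivAt_tsum_mul_pow norm_besselCoeff_le q).differentiableAt.hasDerivAt

lemma hasDerivAt_besselYSeries (q : ℂ) :
    HasDerivAt besselYSeries (deriv besselYSeries q) q :=
  (hasDerivAt_tsum_mul_pow norm_psiInt_mul_besselCoeff_le q).differentiableAt.hasDerivAt

lemma deriv_besselJSeries (q : ℂ) :
    deriv besselJSeries q = ∑' k : ℕ, (k + 1) * besselCoeff (k + 1) * q ^ k :=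
  (hasDerivAt_tsum_mul_pow norm_besselCoeff_le q).deriv

lemma mul_deriv_besselJSeries (q : ℂ) :
    q * deriv besselJSeries q = ∑' k : ℕ, k * besselCoeff k * q ^ k := by
  rw [deriv_besselJSeries, tsum_nat_mul_mul_pow norm_nat_mul_besselCoeff_le]

lemma mul_deriv_besselYSeries (q : ℂ) :
    q * deriv besselYSeries q = ∑' k : ℕ, k * (psiInt (k + 1) * besselCoeff k) * q ^ k := by
  rw [tsum_nat_mul_mul_pow norm_nat_mul_psiInt_mul_besselCoeff_le,
    ← (hasDerivAt_tsum_mul_pow norm_psiInt_mul_besselCoeff_le q).deriv]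
  rfl

/-- The differential equation of `besselJSeries`: the derivative of `q ↦ q * f q`, with `f` the
derivative of the series, is minus a quarter of the series. -/
lemma hasDerivAt_mul_deriv_besselJSeries (q : ℂ) :
    HasDerivAt (fun q => q * deriv besselJSeries q) (-(1 / 4) * besselJSeries q) q := by
  simp only [mul_deriv_besselJSeries]
  refine (hasDerivAt_tsum_mul_pow norm_nat_mul_besselCoeff_le q).congr_deriv ?_
  rw [besselJSeries, ← tsum_mul_left]
  refine tsum_congr fun k => ?_
  have := besselCoeff_succ k
  push_cast
  linear_combination q ^ k * this

/-- The differential equation of `besselYSeries`, with the derivative of `besselJSeries` as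
inhomogeneous term. -/
lemma hasDerivAt_mul_deriv_besselYSeries (q : ℂ) :
    HasDerivAt (fun q => q * deriv besselYSeries q)
      (-(1 / 4) * besselYSeries q + deriv besselJSeries q) q := by
  simp only [mul_deriv_besselYSeries]
  refine (hasDerivAt_tsum_mul_pow norm_nat_mul_psiInt_mul_besselCoeff_le q).congr_deriv ?_
  have hs : Summable fun k : ℕ => (k + 1) * besselCoeff (k + 1) * q ^ k := by
    refine summable_mul_pow_of_norm_le (M := 1) (fun k => ?_) q
    have := norm_nat_mul_besselCoeff_le (k + 1)
    push_cast at this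
    refine this.trans ?_
    gcongr
    exact k.le_succ
  rw [besselYSeries, deriv_besselJSeries, ← tsum_mul_left,
    ← ((summable_mul_pow_of_norm_le norm_psiInt_mul_besselCoeff_le q).mul_left _).tsum_add hs]
  refine tsum_congr fun k => ?_
  have h := besselCoeff_succ k
  have h1 : (k + 1 : ℂ) ≠ 0 := by exact_mod_cast k.succ_ne_zero
  rw [psiInt_succ_succ]
  push_cast
  have h2 : (k + 1 : ℂ) * ((k + 1) * ((psiInt (k + 1) + 1 / (k + 1)) * besselCoeff (k + 1))) =
      psiInt (k + 1) * ((k + 1) ^ 2 * besselCoeff (k + 1)) + (k + 1) * besselCoeff (k + 1) := by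
    field_simp
  rw [h2, h]
  ring

lemma besselJSeries_zero : besselJSeries 0 = 1 := by
  rw [besselJSeries, tsum_mul_zero_pow, besselCoeff_zero]

lemma besselYSeries_zero : besselYSeries 0 = -Real.eulerMascheroniConstant := by
  rw [besselYSeries, tsum_mul_zero_pow (fun k => psiInt (k + 1) * besselCoeff k),
    besselCoeff_zero, zero_add, psiInt_one]
  simp

lemma hankelH_zero_apply (z : ℂ) :
    hankelH 0 z = besselJSeries (z ^ 2) +
      2 * I / Real.pi * (Complex.log (z / 2) * besselJSeries (z ^ 2) - besselYSeries (z ^ 2)) := by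
  have h1 : besselJ 0 z = besselJSeries (z ^ 2) := by
    simp only [besselJ, besselJSeries, besselCoeff, pow_zero, one_mul, zero_add]
    refine tsum_congr fun k => ?_
    rw [pow_mul]
    ring
  have h2 : ∑' k : ℕ, ((psiInt (k + 1) + psiInt (0 + k + 1) : ℝ) : ℂ) * (-(1/4 : ℂ)) ^ k *
      z ^ (2 * k) / ((Nat.factorial k : ℂ) * (Nat.factorial (0 + k) : ℂ)) =
      2 * besselYSeries (z ^ 2) := by
    rw [besselYSeries, ← tsum_mul_left]
    refine tsum_congr fun k => ?_
    rw [zero_add, besselCoeff, pow_mul]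
    push_cast
    ring
  have h3 : besselY 0 z = 2 / Real.pi * Complex.log (z / 2) * besselJSeries (z ^ 2) -
      1 / Real.pi * (2 * besselYSeries (z ^ 2)) := by
    rw [besselY, h2, h1]
    simp
  rw [hankelH, if_pos le_rfl, Int.toNat_zero, h1, h3]
  ring

/-- Solutions of the Bessel equation of order zero normalised to have value `1` plus a logarithm
at the origin. -/
lemma isBesselPair_series (c : ℂ) :
    IsBesselPair (1 - c * Real.log 2 + c * Real.eulerMascheroniConstant) c
      (fun x : ℝ => besselJSeries ((x : ℂ) ^ 2) * (1 + c * (Real.log x - Real.log 2)) -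
        c * besselYSeries ((x : ℂ) ^ 2))
      (fun x : ℝ => 2 * ((x : ℂ) ^ 2 * deriv besselJSeries ((x : ℂ) ^ 2)) *
          (1 + c * (Real.log x - Real.log 2)) +
        c * besselJSeries ((x : ℂ) ^ 2) -
        c * (2 * ((x : ℂ) ^ 2 * deriv besselYSeries ((x : ℂ) ^ 2)))) := by
  have hcomp : ∀ {f : ℂ → ℂ} {f' : ℂ} {x : ℝ}, HasDerivAt f f' ((x : ℂ) ^ 2) →
      HasDerivAt (fun x : ℝ => f ((x : ℂ) ^ 2)) (f' * (2 * x)) x := fun {f f' x} hf => by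
    have h1 : HasDerivAt (fun z : ℂ => z ^ 2) (2 * x : ℂ) x := by
      simpa using hasDerivAt_pow 2 (x : ℂ)
    exact (hf.comp (x : ℂ) h1).comp_ofReal
  have hlog : ∀ x : ℝ, 0 < x → HasDerivAt (fun x : ℝ => 1 + c * (Real.log x - Real.log 2 : ℂ))
      (c * (x : ℂ)⁻¹) x := fun x hx => by
    have := (Real.hasDerivAt_log hx.ne').ofReal_comp
    rw [ofReal_inv] at this
    exact ((this.sub_const _).const_mul c).const_add 1
  have hlim : ∀ {f : ℂ → ℂ} {f' : ℂ}, HasDerivAt f f' 0 →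
      Tendsto (fun x : ℝ => f ((x : ℂ) ^ 2)) (𝓝[>] 0) (𝓝 (f 0)) := fun {f f'} hf => by
    have h := (hcomp (x := 0) (by simpa using hf)).continuousAt.tendsto
    simp only [ofReal_zero, ne_eq, OfNat.ofNat_ne_zero, not_false_eq_true, zero_pow] at h
    exact h.mono_left nhdsWithin_le_nhds
  -- a differentiable function vanishing at the origin also kills the logarithm
  have hlim_log : ∀ {f : ℂ → ℂ} {f' : ℂ}, HasDerivAt f f' 0 → f 0 = 0 →
      Tendsto (fun x : ℝ => f ((x : ℂ) ^ 2) * (1 + c * (Real.log x - Real.log 2)))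
        (𝓝[>] 0) (𝓝 0) := fun {f f'} hf h0 => by
    have hsq : Tendsto (fun x : ℝ => (x : ℂ) ^ 2) (𝓝[>] 0) (𝓝[≠] 0) := by
      refine tendsto_nhdsWithin_iff.2 ⟨?_, ?_⟩
      · have : Tendsto (fun x : ℝ => (x : ℂ) ^ 2) (𝓝 0) (𝓝 ((0 : ℝ) ^ 2 : ℂ)) :=
          Continuous.tendsto (by fun_prop) 0
        simpa using this.mono_left nhdsWithin_le_nhds
      · filter_upwards [self_mem_nhdsWithin] with x hx
        exact pow_ne_zero 2 (ofReal_ne_zero.2 (ne_of_gt hx))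
    have h1 := hf.tendsto_slope_zero.comp hsq
    have h2 := (tendsto_log_mul_rpow_nhdsGT_zero two_pos).ofReal
    have h3 := ((hlim hf).mul_const (1 - c * Real.log 2 : ℂ)).add ((h1.mul h2).const_mul c)
    simp only [h0, zero_mul, ofReal_zero, mul_zero, add_zero] at h3
    refine h3.congr' ?_
    filter_upwards [self_mem_nhdsWithin] with x hx
    have hx0 : (x : ℂ) ≠ 0 := ofReal_ne_zero.2 (ne_of_gt hx)
    simp only [Function.comp_apply, zero_add, sub_zero, smul_eq_mul, Real.rpow_ofNat]
    push_cast
    field_simp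
    ring
  refine ⟨fun x hx => ?_, fun x hx => ?_, ?_, ?_⟩
  · have hx0 : (x : ℂ) ≠ 0 := ofReal_ne_zero.2 hx.ne'
    refine (((hcomp (hasDerivAt_besselJSeries _)).mul (hlog x hx)).sub
      ((hcomp (hasDerivAt_besselYSeries _)).const_mul c)).congr_deriv ?_
    field_simp
  · have hx0 : (x : ℂ) ≠ 0 := ofReal_ne_zero.2 hx.ne'
    refine (((((hcomp (hasDerivAt_mul_deriv_besselJSeries _)).const_mul 2).mul (hlog x hx)).add
      ((hcomp (hasDerivAt_besselJSeries _)).const_mul c)).sub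
      (((hcomp (hasDerivAt_mul_deriv_besselYSeries _)).const_mul 2).const_mul c)).congr_deriv ?_
    field_simp
    ring
  · have h1 := hlim_log ((hasDerivAt_besselJSeries 0).sub_const 1)
      (by rw [besselJSeries_zero, sub_self])
    have h2 := hlim ((hasDerivAt_besselYSeries 0).add_const (Real.eulerMascheroniConstant : ℂ))
    rw [besselYSeries_zero, neg_add_cancel] at h2
    have h3 := h1.sub (h2.const_mul c)
    rw [mul_zero, sub_zero] at h3
    refine h3.congr fun x => ?_
    ring
  · have h1 := (hlim_log (hasDerivAt_mul_deriv_besselJSeries 0) (zero_mul _)).const_mul 2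
    have h2 := (hlim (hasDerivAt_besselJSeries 0)).const_mul c
    have h3 := ((hlim (hasDerivAt_mul_deriv_besselYSeries 0)).const_mul 2).const_mul c
    have h4 := (h1.add h2).sub h3
    rw [besselJSeries_zero] at h4
    simp only [zero_mul, mul_zero, zero_add, mul_one, sub_zero] at h4
    refine h4.congr fun x => ?_
    ring

end HankelIntegral

/-- the semi-convergent integral `∫_0^∞ H_0(v) dv` equals `1`. -/
theorem stmt7 :
    Tendsto (fun t : ℝ => ∫ v in (0:ℝ)..t, hankelH 0 (v : ℂ)) atTop (nhds 1) := by
  have h := (isBesselPair_series (2 * I / Real.pi)).tendsto_integral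
  have e : ∀ c : ℂ, 1 - c * Real.log 2 + c * Real.eulerMascheroniConstant -
      c * Real.eulerMascheroniConstant + c * Real.log 2 = 1 := fun c => by ring
  rw [e] at h
  refine h.congr' ?_
  filter_upwards [eventually_ge_atTop 0] with t ht
  refine intervalIntegral.integral_congr_ae (Eventually.of_forall fun v hv => ?_)
  rw [Set.uIoc_of_le ht] at hv
  have hv0 : 0 < v := hv.1
  have hlog : Complex.log ((v : ℂ) / 2) = Real.log v - Real.log 2 := by
    rw [← ofReal_sub, ← Real.log_div hv0.ne' two_ne_zero, ofReal_log (by positivity)]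
    push_cast
    rfl
  rw [hankelH_zero_apply, hlog]
  ring
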